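/- Let Δ ≥ 9 be an integer and let G be a minimal counterexample to the bound χ'_s ≤ 3Δ − 3 for graphs with Mad < 8/3 and maximum degree at most Δ. If u₁ and u₂ are adjacent vertices of G* both having degree 2 in G*, then both u₁ and u₂ are special. -/

import Mathlib

open scoped Classical

namespace StrongEC

/-- Two edges of `G` conflict for strong edge-coloring: they are distinct and either share
an endpoint or are both adjacent to a common edge of `G`. -/
def Conflict {V : Type*} (G : SimpleGraph V) (e e' : Sym2 V) : Prop :=
  e ≠ e' ∧ ((∃ v, v ∈ e ∧ v ∈ e') ∨
    ∃ f ∈ G.edgeSet, (∃ v, v ∈ e ∧ v ∈ f) ∧ (∃ w, w ∈ e' ∧ w ∈ f))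

/-- `C` is a strong edge-coloring of `G` with `k` colors. -/
def IsStrongColoring {V : Type*} (G : SimpleGraph V) {k : ℕ} (C : Sym2 V → Fin k) : Prop :=
  ∀ e ∈ G.edgeSet, ∀ e' ∈ G.edgeSet, Conflict G e e' → C e ≠ C e'

/-- `G` admits a strong `k`-edge-coloring. -/
def HasStrongColoring {V : Type*} (G : SimpleGraph V) (k : ℕ) : Prop :=
  ∃ C : Sym2 V → Fin k, IsStrongColoring G C

/-- The strong chromatic index of `G`: the least `k` such that `G` admits a strong
`k`-edge-coloring. -/
noncomputable def strongChromaticIndex {V : Type*} (G : SimpleGraph V) : ℕ :=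
  sInf {k | HasStrongColoring G k}

/-- The maximum average degree of a finite graph `G`: the supremum over nonempty vertex
subsets `A` of `2 * e(A) / |A|`, where `e(A)` is the number of edges of `G` inside `A`
(this equals the maximum of `2|E(H)|/|V(H)|` over all subgraphs `H` with at least one
vertex). -/
noncomputable def mad {V : Type*} (G : SimpleGraph V) : ℝ :=
  sSup {x : ℝ | ∃ A : Finset V, A.Nonempty ∧
    x = 2 * ({e ∈ G.edgeSet | ∀ v ∈ e, v ∈ A}.ncard : ℝ) / (A.card : ℝ)}

/-- The graph `G*` obtained from `G` by deleting all vertices of degree 1 in `G`. -/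
noncomputable def core {V : Type*} [Fintype V] (G : SimpleGraph V) : SimpleGraph V :=
  SimpleGraph.fromRel (fun u v => G.Adj u v ∧ G.degree u ≠ 1 ∧ G.degree v ≠ 1)

/-- The number of vertices of degree at least 2. -/
noncomputable def twoPlusCount {W : Type} [Fintype W] (H : SimpleGraph W) : ℕ :=
  (Finset.univ.filter (fun v : W => 2 ≤ H.degree v)).card

/-- A graph with maximum average degree less than `8/3` and maximum degree at most `Δ`. -/
def GoodA (Δ : ℕ) {W : Type} [Fintype W] (H : SimpleGraph W) : Prop :=
  mad H < 8 / 3 ∧ H.maxDegree ≤ Δ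

/-- `G` is a minimal counterexample to the bound `χ'_s ≤ 3Δ - 3` for graphs with
`Mad < 8/3` and maximum degree at most `Δ`. -/
def MinCexA (Δ : ℕ) {V : Type} [Fintype V] (G : SimpleGraph V) : Prop :=
  GoodA Δ G ∧ ¬ HasStrongColoring G (3 * Δ - 3) ∧
    ∀ (W : Type) [Fintype W] (H : SimpleGraph W), GoodA Δ H →
      (twoPlusCount H < twoPlusCount G ∨
        (twoPlusCount H = twoPlusCount G ∧ H.edgeSet.ncard < G.edgeSet.ncard)) →
      HasStrongColoring H (3 * Δ - 3)

/-- `u` is special: it has degree 2 in `G*` and a neighbor in `G*` of degree at least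
`Δ - 1` in `G*`. -/
def Special (Δ : ℕ) {V : Type} [Fintype V] (G : SimpleGraph V) (u : V) : Prop :=
  (core G).degree u = 2 ∧ ∃ w, (core G).Adj u w ∧ Δ - 1 ≤ (core G).degree w

lemma sne {W : Type*} {a b c d : W} (h1 : a ≠ c ∨ b ≠ d) (h2 : a ≠ d ∨ b ≠ c) :
    s(a, b) ≠ s(c, d) := by
  intro h
  rcases Sym2.eq_iff.1 h with ⟨h3, h4⟩ | ⟨h3, h4⟩
  · exact h1.elim (fun h => h h3) (fun h => h h4)
  · exact h2.elim (fun h => h h3) (fun h => h h4)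

/-- Vertex form of a strong coloring. -/
def VC {W : Type*} (H : SimpleGraph W) {k : ℕ} (C : Sym2 W → Fin k) : Prop :=
  ∀ a b c d, H.Adj a b → H.Adj c d → s(a, b) ≠ s(c, d) → (a = c ∨ H.Adj a c) →
    C s(a, b) ≠ C s(c, d)

lemma vc_iff {W : Type*} (H : SimpleGraph W) {k : ℕ} (C : Sym2 W → Fin k) :
    IsStrongColoring H C ↔ VC H C := by
  constructor
  · intro h a b c d hab hcd hne hac
    refine h _ hab _ hcd ⟨hne, ?_⟩
    rcases hac with rfl | hac
    · exact Or.inl ⟨a, by simp, by simp⟩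
    · exact Or.inr ⟨s(a, c), hac, ⟨a, by simp, by simp⟩, ⟨c, by simp, by simp⟩⟩
  · intro h e he e' he' hc
    obtain ⟨hne, hc⟩ := hc
    have key : ∃ a ∈ e, ∃ c ∈ e', a = c ∨ H.Adj a c := by
      rcases hc with ⟨v, hv, hv'⟩ | ⟨f, hf, ⟨v, hv, hvf⟩, ⟨w, hw, hwf⟩⟩
      · exact ⟨v, hv, v, hv', Or.inl rfl⟩
      · refine ⟨v, hv, w, hw, ?_⟩
        by_cases hvw : v = w
        · exact Or.inl hvw
        · right
          have : f = s(v, w) := ((Sym2.mem_and_mem_iff hvw).1 ⟨hvf, hwf⟩)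
          rw [this] at hf
          exact hf
    obtain ⟨a, ha, c, hcc, hac⟩ := key
    obtain ⟨b, rfl⟩ := Sym2.mem_iff_exists.1 ha
    obtain ⟨d, rfl⟩ := Sym2.mem_iff_exists.1 hcc
    exact h a b c d he he' hne hac

/-- Choosing two disjoint color sets. -/
lemma choose_sets {α : Type*} [DecidableEq α] (m : ℕ) (L1 L2 : Finset α)
    (h1 : m ≤ L1.card) (h2 : m ≤ L2.card) (h12 : 2 * m ≤ (L1 ∪ L2).card) :
    ∃ S1 ⊆ L1, ∃ S2 ⊆ L2, Disjoint S1 S2 ∧ S1.card = m ∧ S2.card = m := by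
  by_cases h : m ≤ (L1 \ L2).card
  · obtain ⟨S1, hS1, hc1⟩ := Finset.exists_subset_card_eq h
    obtain ⟨S2, hS2, hc2⟩ := Finset.exists_subset_card_eq h2
    refine ⟨S1, hS1.trans Finset.sdiff_subset, S2, hS2, ?_, hc1, hc2⟩
    exact Finset.disjoint_of_subset_left hS1
      (Finset.disjoint_of_subset_right hS2 Finset.sdiff_disjoint)
  · push Not at h
    obtain ⟨S1, hS, hS1, hc1⟩ := Finset.exists_subsuperset_card_eq
      (Finset.sdiff_subset : L1 \ L2 ⊆ L1) h.le h1
    have hsub : (L1 ∪ L2) \ S1 ⊆ L2 \ S1 := by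
      intro z hz
      simp only [Finset.mem_sdiff, Finset.mem_union] at hz ⊢
      refine ⟨?_, hz.2⟩
      by_contra hz2
      exact hz.2 (hS (by simp only [Finset.mem_sdiff]; tauto))
    have hcard : m ≤ (L2 \ S1).card := by
      have h3 := Finset.card_le_card hsub
      have h4 := Finset.le_card_sdiff S1 (L1 ∪ L2)
      omega
    obtain ⟨S2, hS2, hc2⟩ := Finset.exists_subset_card_eq hcard
    refine ⟨S1, hS1, S2, hS2.trans Finset.sdiff_subset, ?_, hc1, hc2⟩
    exact Finset.disjoint_of_subset_right hS2 Finset.disjoint_sdiff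

lemma choose_colors (Δ : ℕ) (hΔ : 9 ≤ Δ) (A B : Finset (Fin (3 * Δ - 3)))
    (c1 c2 : Fin (3 * Δ - 3)) (hA : A.card ≤ Δ) (hB : B.card ≤ Δ)
    (h : (insert c2 A ∩ insert c1 B).card ≤ Δ) :
    ∃ x, x ∉ A ∪ B ∧ ∃ S1 S2 : Finset (Fin (3 * Δ - 3)), Disjoint S1 S2 ∧ x ∉ S1 ∧ x ∉ S2 ∧
      S1.card = Δ - 2 ∧ S2.card = Δ - 2 ∧ Disjoint S1 (insert c2 A) ∧
      Disjoint S2 (insert c1 B) := by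
  have hx : ∃ x, x ∉ A ∪ B := by
    by_contra hcon
    push Not at hcon
    have h1 : A ∪ B = Finset.univ := Finset.eq_univ_iff_forall.2 hcon
    have h2 := Finset.card_union_le A B
    rw [h1, Finset.card_univ, Fintype.card_fin] at h2
    omega
  obtain ⟨x, hx⟩ := hx
  have cA := Finset.card_insert_le c2 A
  have cB := Finset.card_insert_le c1 B
  have e1 := Finset.le_card_sdiff (insert x (insert c2 A)) Finset.univ
  have e2 := Finset.le_card_sdiff (insert x (insert c1 B)) Finset.univ
  have e3 := Finset.le_card_sdiff (insert x (insert c2 A ∩ insert c1 B)) Finset.univ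
  have i1 := Finset.card_insert_le x (insert c2 A)
  have i2 := Finset.card_insert_le x (insert c1 B)
  have i3 := Finset.card_insert_le x (insert c2 A ∩ insert c1 B)
  rw [Finset.card_univ, Fintype.card_fin] at e1 e2 e3
  have e4 : Finset.univ \ (insert x (insert c2 A ∩ insert c1 B)) =
    (Finset.univ \ insert x (insert c2 A)) ∪ (Finset.univ \ insert x (insert c1 B)) := by
    ext z
    simp only [Finset.mem_sdiff, Finset.mem_union, Finset.mem_insert, Finset.mem_inter,
      Finset.mem_univ, true_and]
    tauto
  rw [e4] at e3
  obtain ⟨S1, hS1, S2, hS2, hd, k1, k2⟩ := choose_sets (Δ - 2)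
    (Finset.univ \ insert x (insert c2 A)) (Finset.univ \ insert x (insert c1 B))
    (by omega) (by omega) (by omega)
  refine ⟨x, hx, S1, S2, hd, ?_, ?_, k1, k2, ?_, ?_⟩
  · intro hh
    simpa using hS1 hh
  · intro hh
    simpa using hS2 hh
  · rw [Finset.disjoint_left]
    intro z hz
    have := hS1 hz
    simp only [Finset.mem_sdiff, Finset.mem_insert, Finset.mem_univ, true_and] at this ⊢
    tauto
  · rw [Finset.disjoint_left]
    intro z hz
    have := hS2 hz
    simp only [Finset.mem_sdiff, Finset.mem_insert, Finset.mem_univ, true_and] at this ⊢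
    tauto

lemma swap_choice {α : Type*} [DecidableEq α] (Δ : ℕ) (A B : Finset α) (c c' c2 : α)
    (hA : A.card ≤ Δ) (hB : B.card ≤ Δ) (hc : c ∈ A) (hc' : c' ∈ A) (hne : c ≠ c') :
    (c ≠ c2 ∧ (insert c2 A ∩ insert c B).card ≤ Δ) ∨
    (c' ≠ c2 ∧ (insert c2 A ∩ insert c' B).card ≤ Δ) := by
  by_cases h2 : c2 ∈ A
  · have : ∀ z, (insert c2 A ∩ insert z B).card ≤ Δ := by
      intro z
      rw [Finset.insert_eq_of_mem h2]
      exact (Finset.card_le_card Finset.inter_subset_left).trans hA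
    by_cases h : c = c2
    · exact Or.inr ⟨fun h' => hne (h.trans h'.symm), this _⟩
    · exact Or.inl ⟨h, this _⟩
  · have n1 : c ≠ c2 := fun h => h2 (h ▸ hc)
    have n2 : c' ≠ c2 := fun h => h2 (h ▸ hc')
    by_cases hb : c ∈ B
    · left
      refine ⟨n1, ?_⟩
      rw [Finset.insert_eq_of_mem hb]
      exact (Finset.card_le_card Finset.inter_subset_right).trans hB
    by_cases hb' : c' ∈ B
    · right
      refine ⟨n2, ?_⟩
      rw [Finset.insert_eq_of_mem hb']
      exact (Finset.card_le_card Finset.inter_subset_right).trans hB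
    left
    refine ⟨n1, ?_⟩
    have hsub : insert c2 A ∩ insert c B ⊆ insert c2 (A.erase c') := by
      intro z hz
      simp only [Finset.mem_inter, Finset.mem_insert, Finset.mem_erase] at hz ⊢
      grind
    have h3 := Finset.card_le_card hsub
    have h4 := Finset.card_insert_le c2 (A.erase c')
    have h5 := Finset.card_erase_add_one hc'
    omega

/-- The configuration around the two adjacent core 2-vertices. -/
structure Cfg {W : Type} (K : SimpleGraph W) (u1 u2 v1 v2 w : W) : Prop where
  a12 : K.Adj u1 u2
  a1 : K.Adj u1 v1
  a2 : K.Adj u2 v2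
  n1 : v1 ≠ u2
  n2 : v2 ≠ u1
  p1 : ∀ y, K.Adj u1 y → y = u2 ∨ y = v1 ∨ ∀ z, K.Adj y z → z = u1
  p2 : ∀ y, K.Adj u2 y → y = u1 ∨ y = v2 ∨ ∀ z, K.Adj y z → z = u2
  aw : K.Adj v1 w
  nw : w ≠ u1
  pw : ∀ z, K.Adj w z → z = v1

/-- Pendant neighbours of `u`. -/
def Pend {W : Type} (K : SimpleGraph W) (u u' v : W) : Set W :=
  {y | K.Adj u y ∧ y ≠ u' ∧ y ≠ v}

/-- The reduced graph. -/
def red {W : Type} (K : SimpleGraph W) (u1 u2 v1 v2 : W) : SimpleGraph W where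
  Adj a b := K.Adj a b ∧ a ∉ Pend K u1 u2 v1 ∪ Pend K u2 u1 v2 ∧
    b ∉ Pend K u1 u2 v1 ∪ Pend K u2 u1 v2 ∧ s(a, b) ≠ s(u1, u2)
  symm := ⟨fun a b h => ⟨h.1.symm, h.2.2.1, h.2.1, by rw [Sym2.eq_swap]; exact h.2.2.2⟩⟩
  loopless := ⟨fun a h => K.loopless.irrefl a h.1⟩

lemma ext_coloring (Δ : ℕ) (hΔ : 9 ≤ Δ) {W : Type} [Fintype W] (K : SimpleGraph W)
    (hdeg : K.maxDegree ≤ Δ) {u1 u2 v1 v2 w : W} (hc : Cfg K u1 u2 v1 v2 w)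
    (C : Sym2 W → Fin (3 * Δ - 3)) (hC : VC (red K u1 u2 v1 v2) C)
    (A B : Finset (Fin (3 * Δ - 3)))
    (hA : ∀ y, (red K u1 u2 v1 v2).Adj v1 y → C s(v1, y) ∈ A)
    (hB : ∀ y, (red K u1 u2 v1 v2).Adj v2 y → C s(v2, y) ∈ B)
    (hAc : A.card ≤ Δ) (hBc : B.card ≤ Δ)
    (hne : C s(v1, u1) ≠ C s(v2, u2))
    (hcard : (insert (C s(v2, u2)) A ∩ insert (C s(v1, u1)) B).card ≤ Δ) :
    ∃ D : Sym2 W → Fin (3 * Δ - 3), VC K D := by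
  obtain ⟨x, hx, S1, S2, hS, hx1, hx2, k1, k2, d1, d2⟩ :=
    choose_colors Δ hΔ A B _ _ hAc hBc hcard
  have hk : 0 < 3 * Δ - 3 := by omega
  have : Nonempty (Fin (3 * Δ - 3)) := ⟨⟨0, hk⟩⟩
  have hcP : ∀ (u u' v : W) (S : Finset (Fin (3 * Δ - 3))), K.Adj u u' → K.Adj u v → v ≠ u' →
      S.card = Δ - 2 → ∃ g : W → Fin (3 * Δ - 3), (∀ y ∈ Pend K u u' v, g y ∈ S) ∧
        Set.InjOn g (Pend K u u' v) := by
    intro u u' v S h1 h2 h3 h4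
    have e : Pend K u u' v = (((K.neighborFinset u).erase u').erase v : Finset W) := by
      ext z
      simp only [Pend, Set.mem_ofPred_eq, Finset.coe_erase, SimpleGraph.coe_neighborFinset,
        Set.mem_sdiff, SimpleGraph.mem_neighborSet, Set.mem_singleton_iff]
      tauto
    have hle : (Pend K u u' v).encard ≤ (S : Set (Fin (3 * Δ - 3))).encard := by
      rw [e, Set.encard_coe_eq_coe_finsetCard, Set.encard_coe_eq_coe_finsetCard,
        Finset.card_erase_of_mem (by simp [h2, h3]),
        Finset.card_erase_of_mem (by simp [h1]), SimpleGraph.card_neighborFinset_eq_degree]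
      have := K.degree_le_maxDegree u
      exact_mod_cast (by omega)
    obtain ⟨g, hg, hi⟩ := Set.Finite.exists_injOn_of_encard_le (Set.toFinite _) hle
    exact ⟨g, fun y hy => hg hy, hi⟩
  have hdisj : ∀ y, y ∈ Pend K u1 u2 v1 → y ∈ Pend K u2 u1 v2 → False := by
    intro y h1 h2
    have a := hc.a12.ne
    have := hc.p1 y h1.1
    have := hc.p2 y h2.1
    have := h1.1.symm
    have := h2.1.symm
    have := h1.2
    have := h2.2
    grind
  obtain ⟨g1, m1, i1⟩ := hcP u1 u2 v1 S1 hc.a12 hc.a1 hc.n1 k1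
  obtain ⟨g2, m2, i2⟩ := hcP u2 u1 v2 S2 hc.a12.symm hc.a2 hc.n2 k2
  rw [Finset.disjoint_left] at hS d1 d2
  obtain ⟨g, hgS1, hgS2, hgi⟩ : ∃ g : W → Fin (3 * Δ - 3),
      (∀ y ∈ Pend K u1 u2 v1, g y ∈ S1) ∧ (∀ y ∈ Pend K u2 u1 v2, g y ∈ S2) ∧
      Set.InjOn g (Pend K u1 u2 v1 ∪ Pend K u2 u1 v2) := by
    refine ⟨fun y => if y ∈ Pend K u1 u2 v1 then g1 y else g2 y, ?_, ?_, ?_⟩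
    · intro y hy
      simp only [hy, if_true]
      exact m1 y hy
    · intro y hy
      have : y ∉ Pend K u1 u2 v1 := fun h => hdisj y h hy
      simp only [this, if_false]
      exact m2 y hy
    · intro y hy z hz hyz
      by_cases h1 : y ∈ Pend K u1 u2 v1 <;> by_cases h2 : z ∈ Pend K u1 u2 v1
      · simp only [h1, h2, if_true] at hyz
        exact i1 h1 h2 hyz
      · simp only [h1, h2, if_true, if_false] at hyz
        exact absurd (hyz ▸ m2 z (hz.resolve_left h2)) (hS (m1 y h1))
      · simp only [h1, h2, if_true, if_false] at hyz
        exact absurd (hyz ▸ m2 y (hy.resolve_left h1)) (hS (m1 z h2))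
      · simp only [h1, h2, if_false] at hyz
        exact i2 (hy.resolve_left h1) (hz.resolve_left h2) hyz
  set P1 := Pend K u1 u2 v1 with hP1
  set P2 := Pend K u2 u1 v2 with hP2
  have q1 : ∀ y ∈ P1, K.Adj u1 y ∧ ∀ z, K.Adj y z → z = u1 := by
    intro y hy
    refine ⟨hy.1, ?_⟩
    have := hc.p1 y hy.1
    have := hy.2
    tauto
  have q2 : ∀ y ∈ P2, K.Adj u2 y ∧ ∀ z, K.Adj y z → z = u2 := by
    intro y hy
    refine ⟨hy.1, ?_⟩
    have := hc.p2 y hy.1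
    have := hy.2
    tauto
  have r1 : ∀ y, K.Adj u1 y → y = u2 ∨ y = v1 ∨ y ∈ P1 := by
    intro y hy
    by_cases h : y = u2
    · exact Or.inl h
    by_cases h' : y = v1
    · exact Or.inr (Or.inl h')
    exact Or.inr (Or.inr ⟨hy, h, h'⟩)
  have r2 : ∀ y, K.Adj u2 y → y = u1 ∨ y = v2 ∨ y ∈ P2 := by
    intro y hy
    by_cases h : y = u1
    · exact Or.inl h
    by_cases h' : y = v2
    · exact Or.inr (Or.inl h')
    exact Or.inr (Or.inr ⟨hy, h, h'⟩)
  have u1P : u1 ∉ P1 ∪ P2 := by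
    rintro (h | h)
    · exact h.1.ne rfl
    · exact h.2.1 rfl
  have u2P : u2 ∉ P1 ∪ P2 := by
    rintro (h | h)
    · exact h.2.1 rfl
    · exact h.1.ne rfl
  have hH : ∀ a b, (red K u1 u2 v1 v2).Adj a b ↔ K.Adj a b ∧ a ∉ P1 ∪ P2 ∧ b ∉ P1 ∪ P2 ∧
      s(a, b) ≠ s(u1, u2) := fun a b => Iff.rfl
  generalize red K u1 u2 v1 v2 = H at *
  have s1 : ∀ b, H.Adj u1 b → b = v1 := by
    intro b hb
    have hb' := (hH _ _).1 hb
    rcases r1 b hb'.1 with rfl | h | h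
    · exact absurd rfl hb'.2.2.2
    · exact h
    · exact absurd (Or.inl h) hb'.2.2.1
  have s2 : ∀ b, H.Adj u2 b → b = v2 := by
    intro b hb
    have hb' := (hH _ _).1 hb
    rcases r2 b hb'.1 with rfl | h | h
    · exact absurd Sym2.eq_swap hb'.2.2.2
    · exact h
    · exact absurd (Or.inr h) hb'.2.2.1
  set c1 := C s(v1, u1) with hc1
  set c2 := C s(v2, u2) with hc2
  have f1 : ∀ a b, H.Adj a b → (a = u1 ∨ K.Adj a u1) → C s(a, b) ∈ insert c2 A := by
    intro a b hab h
    rcases h with rfl | h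
    · obtain rfl := s1 b hab
      rw [Sym2.eq_swap]
      exact Finset.mem_insert_of_mem (hA _ hab.symm)
    · rcases r1 a h.symm with rfl | rfl | h
      · obtain rfl := s2 b hab
        rw [Sym2.eq_swap]
        exact Finset.mem_insert_self _ _
      · exact Finset.mem_insert_of_mem (hA _ hab)
      · exact absurd (Or.inl h) ((hH _ _).1 hab).2.1
  have f2 : ∀ a b, H.Adj a b → (a = u2 ∨ K.Adj a u2) → C s(a, b) ∈ insert c1 B := by
    intro a b hab h
    rcases h with rfl | h
    · obtain rfl := s2 b hab
      rw [Sym2.eq_swap]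
      exact Finset.mem_insert_of_mem (hB _ hab.symm)
    · rcases r2 a h.symm with rfl | rfl | h
      · obtain rfl := s1 b hab
        rw [Sym2.eq_swap]
        exact Finset.mem_insert_self _ _
      · exact Finset.mem_insert_of_mem (hB _ hab)
      · exact absurd (Or.inr h) ((hH _ _).1 hab).2.1
  have hp1 : ∀ a b c d y, H.Adj a b → y ∈ P1 → s(c, d) = s(u1, y) → (a = c ∨ K.Adj a c) →
      C s(a, b) ∈ insert c2 A := by
    intro a b c d y hab hy hcd hac
    rcases Sym2.eq_iff.1 hcd with ⟨rfl, rfl⟩ | ⟨rfl, rfl⟩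
    · exact f1 a b hab hac
    · rcases hac with rfl | hac
      · exact absurd (Or.inl hy) ((hH _ _).1 hab).2.1
      · exact f1 a b hab (Or.inl ((q1 _ hy).2 a hac.symm))
  have hp2 : ∀ a b c d y, H.Adj a b → y ∈ P2 → s(c, d) = s(u2, y) → (a = c ∨ K.Adj a c) →
      C s(a, b) ∈ insert c1 B := by
    intro a b c d y hab hy hcd hac
    rcases Sym2.eq_iff.1 hcd with ⟨rfl, rfl⟩ | ⟨rfl, rfl⟩
    · exact f2 a b hab hac
    · rcases hac with rfl | hac
      · exact absurd (Or.inr hy) ((hH _ _).1 hab).2.1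
      · exact f2 a b hab (Or.inl ((q2 _ hy).2 a hac.symm))
  have a1 := hc.a1
  have a2 := hc.a2
  have a12 := hc.a12
  have v1P : v1 ∉ P1 ∪ P2 := by
    rintro (h | h)
    · exact h.2.2 rfl
    · exact a12.ne ((q2 _ h).2 _ a1.symm)
  have v2P : v2 ∉ P1 ∪ P2 := by
    rintro (h | h)
    · exact a12.ne' ((q1 _ h).2 _ a2.symm)
    · exact h.2.2 rfl
  have h1H : H.Adj v1 u1 := (hH _ _).2 ⟨a1.symm, v1P, u1P, sne (Or.inl a1.ne.symm) (Or.inl hc.n1)⟩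
  have h2H : H.Adj v2 u2 := (hH _ _).2 ⟨a2.symm, v2P, u2P, sne (Or.inl hc.n2) (Or.inl a2.ne.symm)⟩
  have c1A : c1 ∈ A := hA _ h1H
  have c2B : c2 ∈ B := hB _ h2H
  have hpx : ∀ a b c d, H.Adj a b → s(c, d) = s(u1, u2) → (a = c ∨ K.Adj a c) →
      C s(a, b) ∈ A ∪ B := by
    intro a b c d hab hcd hac
    rcases Sym2.eq_iff.1 hcd with ⟨rfl, rfl⟩ | ⟨rfl, rfl⟩
    · have := f1 a b hab hac
      simp only [Finset.mem_insert, Finset.mem_union] at this ⊢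
      rcases this with h | h
      · rw [h]; exact Or.inr c2B
      · exact Or.inl h
    · have := f2 a b hab hac
      simp only [Finset.mem_insert, Finset.mem_union] at this ⊢
      rcases this with h | h
      · rw [h]; exact Or.inl c1A
      · exact Or.inr h
  have hHH : ∀ a b c d, H.Adj a b → H.Adj c d → s(a, b) ≠ s(c, d) → (a = c ∨ K.Adj a c) →
      C s(a, b) ≠ C s(c, d) := by
    intro a b c d hab hcd hn hac
    by_cases hac' : a = c ∨ H.Adj a c
    · exact hC a b c d hab hcd hn hac'
    · push Not at hac'
      have hk := hac.resolve_left hac'.1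
      have : s(a, c) = s(u1, u2) := by
        by_contra hcon
        exact hac'.2 ((hH _ _).2 ⟨hk, ((hH _ _).1 hab).2.1, ((hH _ _).1 hcd).2.1, hcon⟩)
      rcases Sym2.eq_iff.1 this with ⟨rfl, rfl⟩ | ⟨rfl, rfl⟩
      · obtain rfl := s1 b hab
        obtain rfl := s2 d hcd
        rw [Sym2.eq_swap, Sym2.eq_swap (a := c)]
        exact hne
      · obtain rfl := s2 b hab
        obtain rfl := s1 d hcd
        rw [Sym2.eq_swap, Sym2.eq_swap (a := c)]
        exact hne.symm
  let D : Sym2 W → Fin (3 * Δ - 3) := fun e =>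
    if h : ∃ y, y ∈ P1 ∪ P2 ∧ y ∈ e then g h.choose else if e = s(u1, u2) then x else C e
  have hD1 : ∀ u y, y ∈ P1 ∪ P2 → u ∉ P1 ∪ P2 → D s(u, y) = g y := by
    intro u y hy hu
    have h : ∃ z, z ∈ P1 ∪ P2 ∧ z ∈ s(u, y) := ⟨y, hy, by simp⟩
    have hs := h.choose_spec
    have : h.choose = y := by
      rcases Sym2.mem_iff.1 hs.2 with h' | h'
      · exact absurd (h' ▸ hs.1) hu
      · exact h'
    simp only [D]
    rw [dif_pos h, this]
  have hD2 : ∀ a b, a ∉ P1 ∪ P2 → b ∉ P1 ∪ P2 →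
      D s(a, b) = if s(a, b) = s(u1, u2) then x else C s(a, b) := by
    intro a b ha hb
    have h : ¬ ∃ z, z ∈ P1 ∪ P2 ∧ z ∈ s(a, b) := by
      rintro ⟨z, hz, hz'⟩
      rcases Sym2.mem_iff.1 hz' with rfl | rfl
      · exact ha hz
      · exact hb hz
    simp only [D]
    rw [dif_neg h]
  have kind : ∀ a b, K.Adj a b → (H.Adj a b ∧ D s(a, b) = C s(a, b)) ∨
      (s(a, b) = s(u1, u2) ∧ D s(a, b) = x) ∨
      (∃ y ∈ P1, s(a, b) = s(u1, y) ∧ D s(a, b) = g y) ∨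
      (∃ y ∈ P2, s(a, b) = s(u2, y) ∧ D s(a, b) = g y) := by
    intro a b hab
    by_cases ha : a ∈ P1 ∪ P2
    · rcases ha with h | h
      · obtain rfl := (q1 _ h).2 _ hab
        right; right; left
        refine ⟨a, h, Sym2.eq_swap, ?_⟩
        rw [Sym2.eq_swap]
        exact hD1 _ _ (Or.inl h) u1P
      · obtain rfl := (q2 _ h).2 _ hab
        right; right; right
        refine ⟨a, h, Sym2.eq_swap, ?_⟩
        rw [Sym2.eq_swap]
        exact hD1 _ _ (Or.inr h) u2P
    by_cases hb : b ∈ P1 ∪ P2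
    · rcases hb with h | h
      · obtain rfl := (q1 _ h).2 _ hab.symm
        right; right; left
        exact ⟨b, h, rfl, hD1 _ _ (Or.inl h) u1P⟩
      · obtain rfl := (q2 _ h).2 _ hab.symm
        right; right; right
        exact ⟨b, h, rfl, hD1 _ _ (Or.inr h) u2P⟩
    have := hD2 a b ha hb
    by_cases he : s(a, b) = s(u1, u2)
    · right; left
      rw [if_pos he] at this
      exact ⟨he, this⟩
    · left
      rw [if_neg he] at this
      exact ⟨(hH _ _).2 ⟨hab, ha, hb, he⟩, this⟩
  have gx : ∀ y, y ∈ P1 ∪ P2 → g y ≠ x := by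
    rintro y (hy | hy) rfl
    · exact hx1 (hgS1 y hy)
    · exact hx2 (hgS2 y hy)
  refine ⟨D, ?_⟩
  intro a b c d hab hcd hn hac
  have hca : c = a ∨ K.Adj c a := hac.imp Eq.symm (fun h => h.symm)
  rcases kind a b hab with ⟨k, e⟩ | ⟨k, e⟩ | ⟨y, hy, k, e⟩ | ⟨y, hy, k, e⟩ <;>
  rcases kind c d hcd with ⟨k', e'⟩ | ⟨k', e'⟩ | ⟨y', hy', k', e'⟩ | ⟨y', hy', k', e'⟩ <;>
  rw [e, e']
  · exact hHH a b c d k k' hn hac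
  · exact fun h => hx (h ▸ hpx a b c d k k' hac)
  · exact fun h => d1 (hgS1 _ hy') (h ▸ hp1 a b c d _ k hy' k' hac)
  · exact fun h => d2 (hgS2 _ hy') (h ▸ hp2 a b c d _ k hy' k' hac)
  · exact fun h => hx (h ▸ hpx c d a b k' k hca)
  · exact absurd (k.trans k'.symm) hn
  · exact (gx _ (Or.inl hy')).symm
  · exact (gx _ (Or.inr hy')).symm
  · exact fun h => d1 (hgS1 _ hy) (h ▸ hp1 c d a b _ k' hy k hca)
  · exact gx _ (Or.inl hy)
  · intro h
    have := hgi (Or.inl hy) (Or.inl hy') h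
    exact hn (by rw [k, k', this])
  · intro h
    have := hgi (Or.inl hy) (Or.inr hy') h
    exact hdisj y hy (this ▸ hy')
  · exact fun h => d2 (hgS2 _ hy) (h ▸ hp2 c d a b _ k' hy k hca)
  · exact gx _ (Or.inr hy)
  · intro h
    have := hgi (Or.inr hy) (Or.inl hy') h
    exact hdisj y' hy' (this ▸ hy)
  · intro h
    have := hgi (Or.inr hy) (Or.inr hy') h
    exact hn (by rw [k, k', this])

lemma main_ext (Δ : ℕ) (hΔ : 9 ≤ Δ) {W : Type} [Fintype W] (K : SimpleGraph W)
    (hdeg : K.maxDegree ≤ Δ) {u1 u2 v1 v2 w : W} (hc : Cfg K u1 u2 v1 v2 w)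
    (hmin : ∀ H : SimpleGraph W, H ≤ K → twoPlusCount H < twoPlusCount K →
      HasStrongColoring H (3 * Δ - 3)) : HasStrongColoring K (3 * Δ - 3) := by
  have hHd : ∀ a b, (red K u1 u2 v1 v2).Adj a b ↔ K.Adj a b ∧
      a ∉ Pend K u1 u2 v1 ∪ Pend K u2 u1 v2 ∧ b ∉ Pend K u1 u2 v1 ∪ Pend K u2 u1 v2 ∧
      s(a, b) ≠ s(u1, u2) := fun a b => Iff.rfl
  have hle : red K u1 u2 v1 v2 ≤ K := fun a b h => h.1
  have hu1 : ∀ y, (red K u1 u2 v1 v2).Adj u1 y → y = v1 := by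
    intro y hy
    by_contra hcon
    refine hy.2.2.1 (Or.inl ⟨hy.1, ?_, hcon⟩)
    rintro rfl
    exact hy.2.2.2 rfl
  have h2 : twoPlusCount (red K u1 u2 v1 v2) < twoPlusCount K := by
    unfold twoPlusCount
    apply Finset.card_lt_card
    rw [Finset.ssubset_iff_of_subset]
    · refine ⟨u1, ?_, ?_⟩
      · simp only [Finset.mem_filter, Finset.mem_univ, true_and]
        rw [← SimpleGraph.card_neighborFinset_eq_degree]
        have hs : ({u2, v1} : Finset W) ⊆ K.neighborFinset u1 := by
          intro z hz
          simp only [Finset.mem_insert, Finset.mem_singleton] at hz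
          rcases hz with rfl | rfl
          · simpa using hc.a12
          · simpa using hc.a1
        have := Finset.card_le_card hs
        rwa [Finset.card_pair hc.n1.symm] at this
      · simp only [Finset.mem_filter, Finset.mem_univ, true_and]
        rw [← SimpleGraph.card_neighborFinset_eq_degree]
        have hs : (red K u1 u2 v1 v2).neighborFinset u1 ⊆ {v1} := by
          intro z hz
          simp only [SimpleGraph.mem_neighborFinset] at hz
          simpa using hu1 z hz
        have := Finset.card_le_card hs
        simp only [Finset.card_singleton] at this
        omega
    · intro z hz
      simp only [Finset.mem_filter, Finset.mem_univ, true_and] at hz ⊢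
      exact hz.trans (SimpleGraph.degree_le_of_le hle)
  obtain ⟨C, hC⟩ := hmin _ hle h2
  rw [vc_iff] at hC
  suffices h : ∃ D : Sym2 W → Fin (3 * Δ - 3), VC K D by
    obtain ⟨D, hD⟩ := h
    exact ⟨D, (vc_iff _ _).2 hD⟩
  have hdegH : ∀ v, (red K u1 u2 v1 v2).degree v ≤ Δ := fun v =>
    ((SimpleGraph.degree_le_of_le hle).trans (K.degree_le_maxDegree v)).trans hdeg
  have wu2 : w ≠ u2 := by
    rintro rfl
    exact hc.a1.ne (hc.pw u1 hc.a12.symm)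
  have wv2 : w ≠ v2 := by
    rintro rfl
    exact hc.n1 (hc.pw u2 hc.a2.symm).symm
  have wP : w ∉ Pend K u1 u2 v1 ∪ Pend K u2 u1 v2 := by
    rintro (h | h)
    · exact hc.a1.ne (hc.pw u1 h.1.symm)
    · exact hc.n1 (hc.pw u2 h.1.symm).symm
  have v1P : v1 ∉ Pend K u1 u2 v1 ∪ Pend K u2 u1 v2 := by
    rintro (h | h)
    · exact h.2.2 rfl
    · have h3 := hc.p2 _ h.1
      have := h.2
      have h4 : ∀ z, K.Adj v1 z → z = u2 := by tauto
      exact hc.a12.ne (h4 _ hc.a1.symm)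
  have u1P : u1 ∉ Pend K u1 u2 v1 ∪ Pend K u2 u1 v2 := by
    rintro (h | h)
    · exact h.1.ne rfl
    · exact h.2.1 rfl
  have hv1w : (red K u1 u2 v1 v2).Adj v1 w := (hHd _ _).2 ⟨hc.aw, v1P, wP, sne (Or.inl hc.a1.ne.symm) (Or.inl hc.n1)⟩
  have hv1u1 : (red K u1 u2 v1 v2).Adj v1 u1 := (hHd _ _).2 ⟨hc.a1.symm, v1P, u1P, sne (Or.inl hc.a1.ne.symm) (Or.inl hc.n1)⟩
  have hww : ∀ y, (red K u1 u2 v1 v2).Adj w y → y = v1 := fun y h => hc.pw y h.1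
  have nw := hc.nw
  have n2 := hc.n2
  have v1w : v1 ≠ w := hc.aw.ne
  have v1u1 : v1 ≠ u1 := hc.a1.ne'
  have u2u1 : u2 ≠ u1 := hc.a12.ne'
  have hExt := ext_coloring Δ hΔ K hdeg hc
  generalize red K u1 u2 v1 v2 = H at *
  let A := (H.neighborFinset v1).image (fun y => C s(v1, y))
  let B := (H.neighborFinset v2).image (fun y => C s(v2, y))
  have hA : ∀ y, H.Adj v1 y → C s(v1, y) ∈ A := fun y hy =>
    Finset.mem_image.2 ⟨y, by simpa using hy, rfl⟩
  have hB : ∀ y, H.Adj v2 y → C s(v2, y) ∈ B := fun y hy =>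
    Finset.mem_image.2 ⟨y, by simpa using hy, rfl⟩
  have hAc : A.card ≤ Δ := Finset.card_image_le.trans (by
    rw [SimpleGraph.card_neighborFinset_eq_degree]; exact hdegH _)
  have hBc : B.card ≤ Δ := Finset.card_image_le.trans (by
    rw [SimpleGraph.card_neighborFinset_eq_degree]; exact hdegH _)
  have hne : C s(v1, u1) ≠ C s(v1, w) :=
    hC _ _ _ _ hv1u1 hv1w (sne (Or.inr nw.symm) (Or.inl v1w)) (Or.inl rfl)
  rcases swap_choice Δ A B (C s(v1, u1)) (C s(v1, w)) (C s(v2, u2)) hAc hBc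
    (hA _ hv1u1) (hA _ hv1w) hne with ⟨k1, k2⟩ | ⟨k1, k2⟩
  · exact hExt C hC A B hA hB hAc hBc k1 k2
  · let σ := Equiv.swap u1 w
    have hσ : ∀ a b, H.Adj a b → H.Adj (σ a) (σ b) := by
      intro a b hab
      have key : ∀ a b, H.Adj a b → a ≠ u1 → a ≠ w → H.Adj (σ a) (σ b) := by
        intro a b hab h1 h2
        have e : σ a = a := Equiv.swap_apply_of_ne_of_ne h1 h2
        rw [e]
        by_cases hb : b = u1
        · subst hb
          rw [hu1 a hab.symm, show σ b = w from Equiv.swap_apply_left _ _]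
          exact hv1w
        by_cases hb' : b = w
        · subst hb'
          rw [hww a hab.symm, show σ b = u1 from Equiv.swap_apply_right _ _]
          exact hv1u1
        · rw [show σ b = b from Equiv.swap_apply_of_ne_of_ne hb hb']
          exact hab
      by_cases h1 : a = u1
      · subst h1
        have := hu1 b hab
        subst this
        exact (key _ _ hab.symm v1u1 v1w).symm
      by_cases h2 : a = w
      · subst h2
        have := hww b hab
        subst this
        exact (key _ _ hab.symm v1u1 v1w).symm
      exact key a b hab h1 h2
    have e1 : σ v1 = v1 := Equiv.swap_apply_of_ne_of_ne v1u1 v1w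
    have e2 : σ v2 = v2 := Equiv.swap_apply_of_ne_of_ne n2 wv2.symm
    have e3 : σ u2 = u2 := Equiv.swap_apply_of_ne_of_ne u2u1 wu2.symm
    have e4 : σ u1 = w := Equiv.swap_apply_left _ _
    refine hExt (fun e => C (e.map σ)) ?_ A B ?_ ?_ hAc hBc ?_ ?_
    · intro a b c d hab hcd hn hac
      simp only [Sym2.map_mk]
      refine hC _ _ _ _ (hσ _ _ hab) (hσ _ _ hcd) ?_ ?_
      · intro h
        exact hn (Sym2.map.injective σ.injective (by simpa only [Sym2.map_mk] using h))
      · exact hac.imp (fun h => by rw [h]) (hσ _ _)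
    · intro y hy
      simp only [Sym2.map_mk, e1]
      exact hA _ (e1 ▸ hσ _ _ hy)
    · intro y hy
      simp only [Sym2.map_mk, e2]
      exact hB _ (e2 ▸ hσ _ _ hy)
    · simpa only [Sym2.map_mk, e1, e2, e3, e4] using k1
    · simpa only [Sym2.map_mk, e1, e2, e3, e4] using k2

/-- Edges of `G` inside `A`. -/
def eIn {V : Type*} (G : SimpleGraph V) (A : Finset V) : Set (Sym2 V) :=
  {e ∈ G.edgeSet | ∀ v ∈ e, v ∈ A}

lemma mad_lt_iff {V : Type*} [Fintype V] (G : SimpleGraph V) :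
    mad G < 8 / 3 ↔ ∀ A : Finset V, A.Nonempty → 3 * (eIn G A).ncard < 4 * A.card := by
  set S : Set ℝ := {x : ℝ | ∃ A : Finset V, A.Nonempty ∧
    x = 2 * ({e ∈ G.edgeSet | ∀ v ∈ e, v ∈ A}.ncard : ℝ) / (A.card : ℝ)} with hS
  have hmad : mad G = sSup S := rfl
  have hfin : S.Finite := by
    apply (Set.finite_range (fun A : Finset V =>
      2 * ({e ∈ G.edgeSet | ∀ v ∈ e, v ∈ A}.ncard : ℝ) / (A.card : ℝ))).subset
    rintro x ⟨A, _, rfl⟩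
    exact ⟨A, rfl⟩
  have conv : ∀ A : Finset V, A.Nonempty →
      (2 * ((eIn G A).ncard : ℝ) / (A.card : ℝ) < 8 / 3 ↔
        3 * (eIn G A).ncard < 4 * A.card) := by
    intro A hA
    have hpos : (0 : ℝ) < A.card := by exact_mod_cast hA.card_pos
    rw [div_lt_div_iff₀ hpos (by norm_num)]
    constructor
    · intro h
      have : (3 * (eIn G A).ncard : ℝ) < 4 * A.card := by linarith
      exact_mod_cast this
    · intro h
      have : (3 * (eIn G A).ncard : ℝ) < 4 * A.card := by exact_mod_cast h
      linarith
  rw [hmad]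
  constructor
  · intro h A hA
    rw [← conv A hA]
    exact lt_of_le_of_lt (le_csSup hfin.bddAbove ⟨A, hA, rfl⟩) h
  · intro h
    rcases S.eq_empty_or_nonempty with he | he
    · rw [he, Real.sSup_empty]; norm_num
    · obtain ⟨A, hA, hx⟩ := he.csSup_mem hfin
      rw [hx]
      exact (conv A hA).2 (h A hA)

lemma mad_mono {V : Type*} [Fintype V] {H G : SimpleGraph V} (hle : H ≤ G)
    (h : mad G < 8 / 3) : mad H < 8 / 3 := by
  rw [mad_lt_iff] at h ⊢
  intro A hA
  refine lt_of_le_of_lt ?_ (h A hA)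
  have : (eIn H A).ncard ≤ (eIn G A).ncard := by
    refine Set.ncard_le_ncard ?_ (Set.toFinite _)
    rintro e ⟨he, he'⟩
    exact ⟨SimpleGraph.edgeSet_mono hle he, he'⟩
  omega

lemma goodA_mono {Δ : ℕ} {V : Type} [Fintype V] {H G : SimpleGraph V} (hle : H ≤ G)
    (h : GoodA Δ G) : GoodA Δ H := by
  refine ⟨mad_mono hle h.1, SimpleGraph.maxDegree_le_of_forall_degree_le _ _ fun v => ?_⟩
  exact ((SimpleGraph.degree_le_of_le hle).trans (G.degree_le_maxDegree v)).trans h.2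

/-- Add a pendant vertex at `p`. -/
def addP {V : Type} (G : SimpleGraph V) (p : V) : SimpleGraph (Option V) where
  Adj a b := (∃ x y, a = some x ∧ b = some y ∧ G.Adj x y) ∨ (a = some p ∧ b = none) ∨
    (a = none ∧ b = some p)
  symm := ⟨by
    rintro a b (⟨x, y, h1, h2, h3⟩ | ⟨h1, h2⟩ | ⟨h1, h2⟩)
    · exact Or.inl ⟨y, x, h2, h1, h3.symm⟩
    · exact Or.inr (Or.inr ⟨h2, h1⟩)
    · exact Or.inr (Or.inl ⟨h2, h1⟩)⟩
  loopless := ⟨by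
    rintro a (⟨x, y, h1, h2, h3⟩ | ⟨h1, h2⟩ | ⟨h1, h2⟩)
    · rw [h1] at h2
      cases h2
      exact h3.ne rfl
    · rw [h1] at h2; cases h2
    · rw [h1] at h2; cases h2⟩

lemma addP_some {V : Type} (G : SimpleGraph V) (p x y : V) :
    (addP G p).Adj (some x) (some y) ↔ G.Adj x y := by
  simp [addP]

lemma addP_some_none {V : Type} (G : SimpleGraph V) (p x : V) :
    (addP G p).Adj (some x) none ↔ x = p := by
  simp [addP]

lemma addP_none {V : Type} (G : SimpleGraph V) (p : V) (z : Option V) :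
    (addP G p).Adj none z ↔ z = some p := by
  simp [addP]

lemma addP_deg_none {V : Type} [Fintype V] (G : SimpleGraph V) (p : V) :
    (addP G p).degree none ≤ 1 := by
  rw [← SimpleGraph.card_neighborFinset_eq_degree, ← Finset.card_singleton (some p)]
  apply Finset.card_le_card
  intro z hz
  rw [SimpleGraph.mem_neighborFinset, addP_none] at hz
  simpa using hz

lemma addP_deg_p {V : Type} [Fintype V] (G : SimpleGraph V) (p : V) :
    (addP G p).degree (some p) ≤ G.degree p + 1 := by
  rw [← SimpleGraph.card_neighborFinset_eq_degree, ← SimpleGraph.card_neighborFinset_eq_degree]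
  have : (addP G p).neighborFinset (some p) ⊆
      insert none ((G.neighborFinset p).image some) := by
    intro z hz
    rw [SimpleGraph.mem_neighborFinset] at hz
    cases z with
    | none => simp
    | some z =>
      rw [addP_some] at hz
      simpa using hz
  exact (Finset.card_le_card this).trans ((Finset.card_insert_le _ _).trans
    (Nat.add_le_add_right Finset.card_image_le 1))

lemma addP_deg_ne {V : Type} [Fintype V] (G : SimpleGraph V) (p x : V) (hx : x ≠ p) :
    (addP G p).degree (some x) ≤ G.degree x := by
  rw [← SimpleGraph.card_neighborFinset_eq_degree, ← SimpleGraph.card_neighborFinset_eq_degree]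
  have : (addP G p).neighborFinset (some x) ⊆ (G.neighborFinset x).image some := by
    intro z hz
    rw [SimpleGraph.mem_neighborFinset] at hz
    cases z with
    | none => exact absurd ((addP_some_none _ _ _).1 hz) hx
    | some z =>
      rw [addP_some] at hz
      simpa using hz
  exact (Finset.card_le_card this).trans Finset.card_image_le

lemma addP_count {V : Type} [Fintype V] (G : SimpleGraph V) (p : V) (hp : 2 ≤ G.degree p) :
    twoPlusCount (addP G p) ≤ twoPlusCount G := by
  unfold twoPlusCount
  refine le_trans (Finset.card_le_card (t := (Finset.univ.filter
    (fun v : V => 2 ≤ G.degree v)).image some) ?_) Finset.card_image_le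
  intro z hz
  simp only [Finset.mem_filter, Finset.mem_univ, true_and] at hz
  cases z with
  | none =>
    have := addP_deg_none G p
    omega
  | some z =>
    have : 2 ≤ G.degree z := by
      by_cases h : z = p
      · rw [h]; exact hp
      · exact hz.trans (addP_deg_ne G p z h)
    simpa using this

lemma addP_mad {V : Type} [Fintype V] (G : SimpleGraph V) (p : V) (h : mad G < 8 / 3) :
    mad (addP G p) < 8 / 3 := by
  rw [mad_lt_iff] at h ⊢
  intro A hA
  let A' : Finset V := Finset.univ.filter (fun v => some v ∈ A)
  have hc : (A'.image some).card = A'.card :=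
    Finset.card_image_of_injective _ (Option.some_injective V)
  have hsub : A'.image some ⊆ A := by
    intro z hz
    obtain ⟨v, hv, rfl⟩ := Finset.mem_image.1 hz
    exact (Finset.mem_filter.1 hv).2
  have himg : (Set.image (Sym2.map some) (eIn G A')).ncard ≤ (eIn G A').ncard :=
    Set.ncard_image_le (Set.toFinite _)
  have hA'0 : A' = ∅ → (eIn G A').ncard = 0 := by
    intro h0
    rw [Set.ncard_eq_zero (Set.toFinite _)]
    apply Set.eq_empty_of_forall_notMem
    rintro e ⟨he, he'⟩
    induction e with | _ a b =>
    have := he' a (by simp)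
    simp [h0] at this
  have hA' : 3 * (eIn G A').ncard ≤ 4 * A'.card := by
    rcases A'.eq_empty_or_nonempty with h0 | h0
    · rw [hA'0 h0]; omega
    · exact (h A' h0).le
  by_cases hn : none ∈ A
  · have h1 : (eIn (addP G p) A) ⊆ insert s(some p, none) (Set.image (Sym2.map some) (eIn G A')) := by
      rintro e ⟨he, he'⟩
      induction e with | _ a b =>
      have ha := he' a (by simp)
      have hb := he' b (by simp)
      rw [SimpleGraph.mem_edgeSet] at he
      cases a with
      | none =>
        rw [addP_none] at he
        left
        rw [he, Sym2.eq_swap]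
      | some a =>
        cases b with
        | none =>
          rw [addP_some_none] at he
          left
          rw [he]
        | some b =>
          rw [addP_some] at he
          right
          refine ⟨s(a, b), ⟨he, ?_⟩, by simp⟩
          intro v hv
          rcases Sym2.mem_iff.1 hv with rfl | rfl
          · simpa [A'] using ha
          · simpa [A'] using hb
    have h2 := Set.ncard_le_ncard h1 (Set.toFinite _)
    have h3 := Set.ncard_insert_le s(some p, none) (Set.image (Sym2.map some) (eIn G A'))
    have h4 : A'.card + 1 ≤ A.card := by
      rw [← hc, ← Finset.card_insert_of_notMem (a := (none : Option V)) (by simp)]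
      apply Finset.card_le_card
      exact Finset.insert_subset hn hsub
    omega
  · have h1 : (eIn (addP G p) A) ⊆ (Set.image (Sym2.map some) (eIn G A')) := by
      rintro e ⟨he, he'⟩
      induction e with | _ a b =>
      have ha := he' a (by simp)
      have hb := he' b (by simp)
      rw [SimpleGraph.mem_edgeSet] at he
      cases a with
      | none => exact absurd ha hn
      | some a =>
        cases b with
        | none => exact absurd hb hn
        | some b =>
          rw [addP_some] at he
          refine ⟨s(a, b), ⟨he, ?_⟩, by simp⟩
          intro v hv
          rcases Sym2.mem_iff.1 hv with rfl | rfl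
          · simpa [A'] using ha
          · simpa [A'] using hb
    have h2 := Set.ncard_le_ncard h1 (Set.toFinite _)
    have h4 := Finset.card_le_card hsub
    have h5 := hA.card_pos
    rcases A'.eq_empty_or_nonempty with h0 | h0
    · have := hA'0 h0
      omega
    · have := h A' h0
      omega

lemma core_adj {V : Type} [Fintype V] (G : SimpleGraph V) (a b : V) :
    (core G).Adj a b ↔ G.Adj a b ∧ G.degree a ≠ 1 ∧ G.degree b ≠ 1 := by
  unfold core
  rw [SimpleGraph.fromRel_adj]
  constructor
  · rintro ⟨h, h1 | h1⟩
    · exact h1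
    · exact ⟨h1.1.symm, h1.2.2, h1.2.1⟩
  · intro h
    exact ⟨h.1.ne, Or.inl h⟩

lemma pend_of_deg_one {V : Type} [Fintype V] (G : SimpleGraph V) {y u : V} (h : G.Adj u y)
    (hd : G.degree y = 1) : ∀ z, G.Adj y z → z = u := by
  intro z hz
  rw [SimpleGraph.degree_eq_one_iff_existsUnique_adj] at hd
  exact hd.unique hz h.symm

lemma core_two {V : Type} [Fintype V] (G : SimpleGraph V) {u u' : V} (h : (core G).Adj u u')
    (hd : (core G).degree u = 2) : ∃ v, (core G).Adj u v ∧ v ≠ u' ∧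
      ∀ y, G.Adj u y → y = u' ∨ y = v ∨ ∀ z, G.Adj y z → z = u := by
  rw [← SimpleGraph.card_neighborFinset_eq_degree, Finset.card_eq_two] at hd
  obtain ⟨a, b, hab, hs⟩ := hd
  have hmem : ∀ z, (core G).Adj u z ↔ z = a ∨ z = b := by
    intro z
    rw [← SimpleGraph.mem_neighborFinset, hs]
    simp
  have hcov : ∀ y, G.Adj u y → y = a ∨ y = b ∨ ∀ z, G.Adj y z → z = u := by
    intro y hy
    by_cases h1 : G.degree y = 1
    · exact Or.inr (Or.inr (pend_of_deg_one G hy h1))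
    · have : (core G).Adj u y := (core_adj _ _ _).2 ⟨hy, ((core_adj _ _ _).1 h).2.1, h1⟩
      rcases (hmem y).1 this with h | h
      · exact Or.inl h
      · exact Or.inr (Or.inl h)
  rcases (hmem u').1 h with rfl | rfl
  · exact ⟨b, (hmem b).2 (Or.inr rfl), hab.symm, hcov⟩
  · refine ⟨a, (hmem a).2 (Or.inl rfl), hab, fun y hy => ?_⟩
    have := hcov y hy
    tauto

lemma one_special (Δ : ℕ) (hΔ : 9 ≤ Δ) {V : Type}
    [Fintype V] (G : SimpleGraph V) (hG : MinCexA Δ G) (u₁ u₂ : V)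
    (hadj : (core G).Adj u₁ u₂)
    (h1 : (core G).degree u₁ = 2) (h2 : (core G).degree u₂ = 2) :
    Special Δ G u₁ := by
  obtain ⟨v1, hv1, n1, p1⟩ := core_two G hadj h1
  obtain ⟨v2, hv2, n2, p2⟩ := core_two G hadj.symm h2
  refine ⟨h1, v1, hv1, ?_⟩
  by_contra hlt
  obtain ⟨hgood, hnot, hmin⟩ := hG
  have c12 := (core_adj _ _ _).1 hadj
  have cv1 := (core_adj _ _ _).1 hv1
  have cv2 := (core_adj _ _ _).1 hv2
  by_cases hw : ∃ w, G.Adj v1 w ∧ G.degree w = 1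
  · obtain ⟨w, hw, hw1⟩ := hw
    have hcfg : Cfg G u₁ u₂ v1 v2 w :=
      { a12 := c12.1, a1 := cv1.1, a2 := cv2.1, n1 := n1, n2 := n2, p1 := p1, p2 := p2,
        aw := hw, nw := by rintro rfl; exact cv1.2.1 hw1
        pw := pend_of_deg_one G hw hw1 }
    exact hnot (main_ext Δ hΔ G hgood.2 hcfg
      (fun H hle hc => hmin V H (goodA_mono hle hgood) (Or.inl hc)))
  · push Not at hw
    have hdv : G.degree v1 ≤ (core G).degree v1 := by
      rw [← SimpleGraph.card_neighborFinset_eq_degree,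
        ← SimpleGraph.card_neighborFinset_eq_degree]
      apply Finset.card_le_card
      intro z hz
      rw [SimpleGraph.mem_neighborFinset] at hz ⊢
      exact (core_adj _ _ _).2 ⟨hz, cv1.2.2, hw z hz⟩
    have hd2 : 2 ≤ G.degree v1 := by
      have h0 : 0 < G.degree v1 := (G.degree_pos_iff_exists_adj v1).2 ⟨u₁, cv1.1.symm⟩
      have := cv1.2.2
      omega
    have hgoodK : GoodA Δ (addP G v1) := by
      refine ⟨addP_mad G v1 hgood.1,
        SimpleGraph.maxDegree_le_of_forall_degree_le _ _ fun z => ?_⟩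
      cases z with
      | none => have := addP_deg_none G v1; omega
      | some z =>
        by_cases h : z = v1
        · subst h
          have := addP_deg_p G z
          omega
        · exact (addP_deg_ne G v1 z h).trans ((G.degree_le_maxDegree z).trans hgood.2)
    have hpend : ∀ u u' v : V, u ≠ v1 → (v1 = u' ∨ v1 = v ∨ ¬ G.Adj u v1 ∨
        ∃ z, G.Adj v1 z ∧ z ≠ u) →
        (∀ y, G.Adj u y → y = u' ∨ y = v ∨ ∀ z, G.Adj y z → z = u) →
        ∀ y, (addP G v1).Adj (some u) y → y = some u' ∨ y = some v ∨
          ∀ z, (addP G v1).Adj y z → z = some u := by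
      intro u u' v hu hv hp y hy
      cases y with
      | none => exact absurd ((addP_some_none _ _ _).1 hy) hu
      | some y =>
        rw [addP_some] at hy
        rcases hp y hy with h | h | h
        · exact Or.inl (by rw [h])
        · exact Or.inr (Or.inl (by rw [h]))
        · by_cases hyv : y = v1
          · subst hyv
            rcases hv with h' | h' | h' | ⟨z, h', hz2⟩
            · exact Or.inl (by rw [h'])
            · exact Or.inr (Or.inl (by rw [h']))
            · exact absurd hy h'
            · exact absurd (h z h') hz2
          · right; right
            intro z hz
            cases z with
            | none => exact absurd ((addP_some_none _ _ _).1 hz) hyv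
            | some z =>
              rw [addP_some] at hz
              rw [h z hz]
    have hcfg : Cfg (addP G v1) (some u₁) (some u₂) (some v1) (some v2) none :=
      { a12 := (addP_some _ _ _ _).2 c12.1
        a1 := (addP_some _ _ _ _).2 cv1.1
        a2 := (addP_some _ _ _ _).2 cv2.1
        n1 := fun h => n1 (Option.some_injective _ h)
        n2 := fun h => n2 (Option.some_injective _ h)
        p1 := hpend u₁ u₂ v1 cv1.1.ne (Or.inr (Or.inl rfl)) p1
        p2 := hpend u₂ u₁ v2 n1.symm
          (Or.inr (Or.inr (Or.inr ⟨u₁, cv1.1.symm, c12.1.ne⟩))) p2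
        aw := (addP_some_none _ _ _).2 rfl
        nw := by simp
        pw := fun z hz => (addP_none _ _ _).1 hz }
    obtain ⟨C, hC⟩ := main_ext Δ hΔ (addP G v1) hgoodK.2 hcfg
      (fun H hle hc => hmin (Option V) H (goodA_mono hle hgoodK)
        (Or.inl (lt_of_lt_of_le hc (addP_count G v1 hd2))))
    rw [vc_iff] at hC
    refine hnot ⟨fun e => C (e.map some), ?_⟩
    rw [vc_iff]
    intro a b c d hab hcd hn hac
    simp only [Sym2.map_mk]
    refine hC _ _ _ _ ((addP_some _ _ _ _).2 hab) ((addP_some _ _ _ _).2 hcd) ?_ ?_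
    · intro h
      exact hn (Sym2.map.injective (Option.some_injective V)
        (by simpa only [Sym2.map_mk] using h))
    · exact hac.imp (fun h => by rw [h]) (addP_some _ _ _ _).2

/-- In a minimal counterexample `G` to `χ'_s ≤ 3Δ - 3` for graphs with `Mad < 8/3` and
maximum degree at most `Δ ≥ 9`, any two adjacent vertices of degree 2 in `G*` are both
special. -/
theorem minCexA_adjacent_two_vertices_special (Δ : ℕ) (hΔ : 9 ≤ Δ) {V : Type}
    [Fintype V] (G : SimpleGraph V) (hG : MinCexA Δ G) (u₁ u₂ : V)
    (hadj : (core G).Adj u₁ u₂)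
    (h1 : (core G).degree u₁ = 2) (h2 : (core G).degree u₂ = 2) :
    Special Δ G u₁ ∧ Special Δ G u₂ := by
  exact ⟨one_special Δ hΔ G hG u₁ u₂ hadj h1 h2, one_special Δ hΔ G hG u₂ u₁ hadj.symm h2 h1⟩

end StrongEC
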